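/- The quotient of the free group on four generators α, β, γ, δ by the normal closure of the three elements δ²α⁻¹, αβαγ, and δγ⁻¹β⁻¹γ is isomorphic to the group G₂ = ⟨A, B ∣ AB⁻¹A²B²⟩. -/

import Mathlib

/-- The relator `A B⁻¹ A² B²` in the free group on two generators `A = of 0`, `B = of 1`. -/
abbrev rel₂ : Set (FreeGroup (Fin 2)) :=
  {FreeGroup.of 0 * (FreeGroup.of 1)⁻¹ * FreeGroup.of 0 ^ 2 * FreeGroup.of 1 ^ 2}

/-- `G₂ = ⟨A, B ∣ AB⁻¹A²B²⟩` -/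
abbrev G₂ : Type := PresentedGroup rel₂

/-- The relators `δ²α⁻¹`, `αβαγ`, `δγ⁻¹β⁻¹γ` in the free group on four generators
`α = of 0`, `β = of 1`, `γ = of 2`, `δ = of 3`. -/
abbrev rels₀₂ : Set (FreeGroup (Fin 4)) :=
  {FreeGroup.of 3 ^ 2 * (FreeGroup.of 0)⁻¹,
   FreeGroup.of 0 * FreeGroup.of 1 * FreeGroup.of 0 * FreeGroup.of 2,
   FreeGroup.of 3 * (FreeGroup.of 2)⁻¹ * (FreeGroup.of 1)⁻¹ * FreeGroup.of 2}

/-- In a group where `d² = a`, `abac = 1` and `dc⁻¹b⁻¹c = 1`, the elements `d` and `cd²` satisfy the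
relation of `G₂`. -/
theorem rel₂_of_rels₀₂ {G : Type*} [Group G] {a b c d : G} (h₁ : d ^ 2 * a⁻¹ = 1)
    (h₂ : a * b * a * c = 1) (h₃ : d * c⁻¹ * b⁻¹ * c = 1) :
    d * (c * d ^ 2)⁻¹ * d ^ 2 * (c * d ^ 2) ^ 2 = 1 := by
  obtain rfl : d ^ 2 = a := mul_inv_eq_one.mp h₁
  have hb : b⁻¹ = d ^ 2 * c * d ^ 2 := by
    rw [inv_eq_iff_mul_eq_one]
    calc
      _ = (d ^ 2)⁻¹ * (d ^ 2 * b * d ^ 2 * c) * d ^ 2 := by group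
      _ = 1 := by rw [h₂]; group
  rw [hb] at h₃
  calc
    _ = (d ^ 2)⁻¹ * (d * c⁻¹ * (d ^ 2 * c * d ^ 2) * c) * d ^ 2 := by rw [sq (c * d ^ 2)]; group
    _ = 1 := by rw [h₃]; group

/-- The homomorphism `α ↦ A²`, `β ↦ B⁻¹A⁻²`, `γ ↦ BA⁻²`, `δ ↦ A`. -/
def homToG₂ : PresentedGroup rels₀₂ →* G₂ :=
  PresentedGroup.toGroup
    (f := ![.of 0 ^ 2, (.of 1)⁻¹ * (.of 0 ^ 2)⁻¹, .of 1 * (.of 0 ^ 2)⁻¹, .of 0]) <| by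
    have h : (.of 0 * (.of 1)⁻¹ * .of 0 ^ 2 * .of 1 ^ 2 : G₂) = 1 :=
      PresentedGroup.one_of_mem (rels := rel₂) rfl
    rintro r (rfl | rfl | rfl)
    · simp
    · simp only [map_mul, FreeGroup.lift_apply_of, Matrix.cons_val]
      group
    · simp only [map_mul, map_inv, FreeGroup.lift_apply_of, Matrix.cons_val]
      calc
        _ = (.of 0 ^ 2 * (.of 0 * (.of 1)⁻¹ * .of 0 ^ 2 * .of 1 ^ 2) * (.of 0 ^ 2)⁻¹ : G₂) := by
          rw [sq (.of 1 : G₂)]; group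
        _ = 1 := by rw [h]; group

/-- The homomorphism `A ↦ δ`, `B ↦ γδ²`. -/
def homFromG₂ : G₂ →* PresentedGroup rels₀₂ :=
  PresentedGroup.toGroup (f := ![.of 3, .of 2 * .of 3 ^ 2]) <| by
    rintro r rfl
    simpa using rel₂_of_rels₀₂ (G := PresentedGroup rels₀₂)
      (a := .of 0) (b := .of 1) (c := .of 2) (d := .of 3)
      (PresentedGroup.one_of_mem (rels := rels₀₂) (.inl rfl))
      (PresentedGroup.one_of_mem (rels := rels₀₂) (.inr (.inl rfl)))
      (PresentedGroup.one_of_mem (rels := rels₀₂) (.inr (.inr rfl)))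

theorem stmt_9 : Nonempty (PresentedGroup rels₀₂ ≃* G₂) := by
  have h₁ : (.of 3 ^ 2 : PresentedGroup rels₀₂) = .of 0 :=
    mul_inv_eq_one.mp (PresentedGroup.one_of_mem (rels := rels₀₂) (.inl rfl))
  have h₂ : (.of 0 * .of 1 * .of 0 * .of 2 : PresentedGroup rels₀₂) = 1 :=
    PresentedGroup.one_of_mem (rels := rels₀₂) (.inr (.inl rfl))
  have h₃ : ((.of 0)⁻¹ * (.of 2)⁻¹ * (.of 0)⁻¹ : PresentedGroup rels₀₂) = .of 1 := by
    calc
      _ = ((.of 0)⁻¹ * (.of 0 * .of 1 * .of 0 * .of 2) * .of 0 : PresentedGroup rels₀₂)⁻¹ *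
          .of 1 := by group
      _ = .of 1 := by rw [h₂]; group
  refine ⟨homToG₂.toMulEquiv homFromG₂ ?_ ?_⟩
  · ext i
    fin_cases i
    · simpa [homToG₂, homFromG₂] using h₁
    · simpa [homToG₂, homFromG₂, h₁] using h₃
    · simp [homToG₂, homFromG₂]
    · simp [homToG₂, homFromG₂]
  · ext i
    fin_cases i <;> simp [homToG₂, homFromG₂]
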